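/- For every integer n ≥ 0, the bivariate polynomials Q_n(x,q) satisfy Q_{n+1}(x,q) = (q + 2nx)·Q_n(x,q) + 2x(1−x)·∂Q_n(x,q)/∂x, with Q_0(x,q) = 1. -/

import Mathlib

open scoped Classical
noncomputable section

/-- The multiset `{1,1,2,2,…,n,n}` as a list. -/
def baseList (n : ℕ) : List ℕ := (List.range n).flatMap (fun i => [i + 1, i + 1])

/-- A word is Stirling if whenever the same value occurs at positions `i < k`,
every entry strictly between them is greater than that value. -/
def IsStirlingWord (l : List ℕ) : Prop :=
  ∀ i j k : Fin l.length, i < j → j < k → l.get i = l.get k → l.get i < l.get j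

/-- The set `Q_n` of Stirling permutations of order `n`:  rearrangements of the
multiset `{1,1,2,2,…,n,n}` in which all entries between the two occurrences of any
value exceed that value. -/
def stirlingPerms (n : ℕ) : Finset (List ℕ) :=
  ((baseList n).permutations.toFinset).filter IsStirlingWord

/-- Number of descents of `σ ∈ Q_n`: indices `i ∈ {1,…,2n}` (here 0-based) with
`σ_i > σ_{i+1}`, with the convention `σ_{2n+1} = 0`. -/
def desList (l : List ℕ) : ℕ :=
  ((Finset.range l.length).filter (fun i => l.getD (i + 1) 0 < l.getD i 0)).card

/-- The second-order Eulerian polynomial `C_n(x) = ∑_{σ ∈ Q_n} x^{des σ}`. -/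
def Cpoly (n : ℕ) : Polynomial ℚ :=
  ∑ σ ∈ stirlingPerms n, Polynomial.X ^ desList σ

/-- A list of cycles is a valid standard cycle form of a Stirling permutation of the
second kind of order `n` if:  the cycles are disjoint and together use each of
`1,1,2,2,…,n,n` exactly once; both copies of any value lie in the same cycle; each
cycle starts with (one of) its smallest entries; the cycles are listed in increasing
order of their smallest (first) entries; and the word of each cycle reduces to a
Stirling permutation. -/
def IsStirling2 (n : ℕ) (c : List (List ℕ)) : Prop :=
  c.flatten.Perm (baseList n) ∧
  (∀ w ∈ c, w ≠ [] ∧ (∀ v ∈ w, w.count v = 2) ∧ (∀ v ∈ w, w.headI ≤ v) ∧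
      IsStirlingWord w) ∧
  c.Chain' (fun w₁ w₂ => w₁.headI < w₂.headI)

/-- The set `Q_n²` of Stirling permutations of the second kind of order `n`,
each recorded as its standard cycle form (a list of cycles). -/
def stirling2 (n : ℕ) : Finset (List (List ℕ)) :=
  ((((baseList n).permutations.toFinset) ×ˢ (Finset.univ : Finset (Composition (2 * n)))).image
      (fun p => p.1.splitWrtComposition p.2)).filter (IsStirling2 n)

/-- `cyc(σ)`: the number of cycles. -/
def cyc (c : List (List ℕ)) : ℕ := c.length

/-- `cplat(σ)`: the number of cycle plateaus, i.e. entries `c_i` of a cycle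
`(c_1,…,c_{2k})` with `c_i = c_{i+1}`, `1 ≤ i < 2k`. -/
def cplat (c : List (List ℕ)) : ℕ :=
  (c.map (fun w => ((Finset.range w.length).filter
    (fun i => i + 1 < w.length ∧ w.getD i 0 = w.getD (i + 1) 0)).card)).sum

/-- `casc(σ)`: the number of cycle ascents, i.e. entries `c_i` of a cycle
`(c_1,…,c_{2k})` with `c_i < c_{i+1}`, `1 ≤ i < 2k`. -/
def casc (c : List (List ℕ)) : ℕ :=
  (c.map (fun w => ((Finset.range w.length).filter
    (fun i => i + 1 < w.length ∧ w.getD i 0 < w.getD (i + 1) 0)).card)).sum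

/-- `cap(σ)`: the number of cycle ascent plateaus, i.e. entries `c_i` of a cycle
`(c_1,…,c_{2k})` with `c_{i-1} < c_i = c_{i+1}`, `2 ≤ i ≤ 2k-1`. -/
def capSt (c : List (List ℕ)) : ℕ :=
  (c.map (fun w => ((Finset.range w.length).filter
    (fun i => 0 < i ∧ i + 1 < w.length ∧
      w.getD (i - 1) 0 < w.getD i 0 ∧ w.getD i 0 = w.getD (i + 1) 0)).card)).sum

/-- `fix(σ)`: the number of fixed points, i.e. values `k` with `(k,k)` a cycle of `σ`. -/
def fixSt (c : List (List ℕ)) : ℕ :=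
  ((Finset.range c.length).filter (fun i => ∃ k : ℕ, c.getD i [] = [k, k])).card

open MvPolynomial in
/-- `Q_n(x,q) = ∑_{σ ∈ Q_n²} x^{cap(σ)} q^{cyc(σ)}`, as a polynomial in the two
variables `x = X 0` and `q = X 1`. -/
def Qmv (n : ℕ) : MvPolynomial (Fin 2) ℚ :=
  ∑ σ ∈ stirling2 n, X 0 ^ capSt σ * X 1 ^ cyc σ

theorem mem_stirling2 {n : ℕ} {c : List (List ℕ)} : c ∈ stirling2 n ↔ IsStirling2 n c := by
  refine ⟨fun h => (Finset.mem_filter.1 h).2, fun h => Finset.mem_filter.2 ⟨?_, h⟩⟩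
  have hlen : (c.map List.length).sum = 2 * n := by
    rw [← List.length_flatten, h.1.length_eq]
    simp [baseList, mul_comm]
  refine Finset.mem_image.2 ⟨(c.flatten, ⟨c.map List.length, ?_, hlen⟩), ?_, ?_⟩
  · intro i hi
    obtain ⟨w, hw, rfl⟩ := List.mem_map.1 hi
    exact List.length_pos_iff.2 (h.2.1 w hw).1
  · simpa using h.1
  · exact List.eq_iff_flatten_eq.2
      ⟨List.flatten_splitWrtCompositionAux (by simp [List.length_flatten]),
      List.map_length_splitWrtCompositionAux (by simp [List.length_flatten])⟩

theorem baseList_succ (n : ℕ) : baseList (n + 1) = baseList n ++ [n + 1, n + 1] := by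
  simp [baseList, List.range_succ]

theorem lt_of_mem_baseList {n a : ℕ} (h : a ∈ baseList n) : a < n + 1 := by
  simp only [baseList, List.mem_flatMap, List.mem_range, List.mem_cons, List.not_mem_nil,
    or_false, or_self] at h
  obtain ⟨b, hb, h⟩ := h
  omega

theorem IsStirling2.lt {n : ℕ} {c : List (List ℕ)} (h : IsStirling2 n c) {w : List ℕ}
    (hw : w ∈ c) {a : ℕ} (ha : a ∈ w) : a < n + 1 :=
  lt_of_mem_baseList (h.1.mem_iff.1 (List.mem_flatten.2 ⟨w, hw, ha⟩))

theorem isStirlingWord_iff {l : List ℕ} :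
    IsStirlingWord l ↔ ∀ x y, [x, y, x].Sublist l → x < y := by
  constructor
  · intro h x y hs
    obtain ⟨f, hf⟩ := List.sublist_iff_exists_fin_orderEmbedding_get_eq.1 hs
    have h0 := hf ⟨0, by simp⟩
    have h1 := hf ⟨1, by simp⟩
    have h2 := hf ⟨2, by simp⟩
    simp only [List.get_eq_getElem, List.getElem_cons_zero, List.getElem_cons_succ] at h0 h1 h2
    rw [h0, h1]
    exact h _ _ (f ⟨2, by simp⟩) (f.lt_iff_lt.2 (by simp)) (f.lt_iff_lt.2 (by simp))
      (h0.symm.trans h2)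
  · intro h i j k hij hjk hik
    apply h
    nth_rewrite 2 [hik]
    exact List.map_getElem_sublist (is := [i, j, k]) (by simp [hij, hjk, hij.trans hjk])

/-- A double letter `m`, larger than all other letters, may be inserted anywhere in a
Stirling word. -/
theorem isStirlingWord_insert {m : ℕ} {u v : List ℕ} (hu : ∀ a ∈ u, a < m)
    (hv : ∀ a ∈ v, a < m) :
    IsStirlingWord (u ++ m :: m :: v) ↔ IsStirlingWord (u ++ v) := by
  have hmu : m ∉ u := fun h => lt_irrefl _ (hu _ h)
  have hmv : m ∉ v := fun h => lt_irrefl _ (hv _ h)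
  simp only [isStirlingWord_iff]
  constructor
  · intro h x y hs
    exact h x y (hs.trans (List.Sublist.append_left (by simp) u))
  · intro h x y hs
    have hx : x ≤ m := by
      have := hs.subset (show x ∈ [x, y, x] by simp)
      simp only [List.mem_append, List.mem_cons] at this
      rcases this with h | h | h | h
      exacts [(hu _ h).le, h.le, h.le, (hv _ h).le]
    rcases hx.eq_or_lt with rfl | hx
    · have h1 : [y, x].Sublist (x :: v) := by
        clear h hu
        induction u with
        | nil => simpa using hs
        | cons a u ih =>
          simp only [List.mem_cons, not_or] at hmu
          refine ih hmu.2 ?_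
          simpa [List.cons_sublist_cons', hmu.1] using hs
      have := h1.count_le x
      have hc := List.count_eq_zero.2 hmv
      by_cases hxy : y = x
      · subst hxy
        simp [hc] at this
      · exact absurd ((List.sublist_cons_iff.1 h1).resolve_right (by simp [hxy]) |>.subset
          (show x ∈ [y, x] by simp)) hmv
    · by_cases hy : y = m
      · omega
      · apply h
        have := hs.filter (fun a => a ≠ m)
        rwa [List.filter_eq_self.2 (by simp [hy, hx.ne]), List.filter_append,
          List.filter_cons_of_neg (by simp), List.filter_cons_of_neg (by simp),
          List.filter_eq_self.2 (by simpa using fun a ha => (hu a ha).ne),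
          List.filter_eq_self.2 (by simpa using fun a ha => (hv a ha).ne)] at this

/-- Inserting the double letter `n + 1` into a cycle, not at its front. -/
theorem isStirling2_insert {n : ℕ} {c₁ c₂ : List (List ℕ)} {u v : List ℕ} (hu0 : u ≠ [])
    (hu : ∀ a ∈ u, a < n + 1) (hv : ∀ a ∈ v, a < n + 1) :
    IsStirling2 (n + 1) (c₁ ++ (u ++ (n + 1) :: (n + 1) :: v) :: c₂) ↔
      IsStirling2 n (c₁ ++ (u ++ v) :: c₂) := by
  unfold IsStirling2
  refine and_congr ?_ (and_congr ?_ ?_)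
  · rw [baseList_succ, ← List.perm_append_right_iff [n + 1, n + 1] (l₂ := baseList n)]
    apply List.Perm.congr_left
    rw [List.perm_iff_count]
    intro a
    simp only [List.flatten_append, List.flatten_cons, List.count_append, List.count_cons,
      List.count_nil]
    omega
  · have key : ((u ++ (n + 1) :: (n + 1) :: v) ≠ [] ∧
        (∀ a ∈ u ++ (n + 1) :: (n + 1) :: v, (u ++ (n + 1) :: (n + 1) :: v).count a = 2) ∧
        (∀ a ∈ u ++ (n + 1) :: (n + 1) :: v, (u ++ (n + 1) :: (n + 1) :: v).headI ≤ a) ∧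
        IsStirlingWord (u ++ (n + 1) :: (n + 1) :: v)) ↔
        ((u ++ v) ≠ [] ∧ (∀ a ∈ u ++ v, (u ++ v).count a = 2) ∧
        (∀ a ∈ u ++ v, (u ++ v).headI ≤ a) ∧ IsStirlingWord (u ++ v)) := by
      rw [isStirlingWord_insert hu hv]
      have hmu : (n + 1) ∉ u := fun h => lt_irrefl _ (hu _ h)
      have hmv : (n + 1) ∉ v := fun h => lt_irrefl _ (hv _ h)
      obtain ⟨b, u, rfl⟩ := List.exists_cons_of_ne_nil hu0
      refine and_congr (by simp) (and_congr ?_ (and_congr ?_ Iff.rfl))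
      · have hc : ∀ a, a ≠ n + 1 →
            ((b :: u) ++ (n + 1) :: (n + 1) :: v).count a = ((b :: u) ++ v).count a := by
          intro a ha
          simp [List.count_cons, List.count_append, Ne.symm ha]
        constructor
        · intro h a ha
          have hne : a ≠ n + 1 := by
            rintro rfl
            exact (List.mem_append.1 ha).elim hmu hmv
          rw [← hc a hne]
          apply h
          simp only [List.mem_append, List.mem_cons] at ha ⊢
          tauto
        · intro h a ha
          by_cases hne : a = n + 1
          · subst hne
            rw [List.count_append, List.count_cons_self, List.count_cons_self,
              List.count_eq_zero.2 hmu, List.count_eq_zero.2 hmv]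
          · rw [hc a hne]
            apply h
            simp only [List.mem_append, List.mem_cons] at ha ⊢
            tauto
      · have hb : b ≤ n + 1 := (hu b (by simp)).le
        simp only [List.cons_append, List.headI_cons, List.mem_append, List.mem_cons]
        constructor
        · intro h a ha
          exact h a (by tauto)
        · intro h a ha
          rcases ha with ha | ha | ha | ha | ha
          exacts [h a (by tauto), h a (by tauto), ha ▸ hb, ha ▸ hb, h a (by tauto)]
    rw [List.forall_mem_append, List.forall_mem_append, List.forall_mem_cons,
      List.forall_mem_cons, key]
  · have hh : (u ++ (n + 1) :: (n + 1) :: v).headI = (u ++ v).headI := by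
      obtain ⟨b, u, rfl⟩ := List.exists_cons_of_ne_nil hu0
      rfl
    refine (List.isChain_map (R := (· < ·)) List.headI).symm.trans
      (Iff.trans ?_ (List.isChain_map (R := (· < ·)) List.headI))
    simp [hh]

/-- Appending the new cycle `(n + 1, n + 1)`. -/
theorem isStirling2_append {n : ℕ} {c : List (List ℕ)} (h : IsStirling2 n c) :
    IsStirling2 (n + 1) (c ++ [[n + 1, n + 1]]) := by
  refine ⟨?_, ?_, ?_⟩
  · rw [baseList_succ]
    simpa using h.1.append_right _
  · intro w hw
    rcases List.mem_append.1 hw with hw | hw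
    · exact h.2.1 w hw
    · rw [List.mem_singleton.1 hw]
      refine ⟨by simp, by simp, by simp, ?_⟩
      exact (isStirlingWord_insert (u := []) (v := []) (by simp) (by simp)).2
        (fun i => i.elim0)
  · refine List.isChain_append.2 ⟨h.2.2, by simp, ?_⟩
    intro w hw w' hw'
    simp only [List.head?_cons, Option.mem_def, Option.some.injEq] at hw'
    subst hw'
    have hw := List.mem_of_mem_getLast? hw
    obtain ⟨b, t, rfl⟩ := List.exists_cons_of_ne_nil (h.2.1 w hw).1
    exact h.lt hw (by simp)

/-- Removing the cycle `(n + 1, n + 1)`. -/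
theorem IsStirling2.of_append {n : ℕ} {c : List (List ℕ)}
    (h : IsStirling2 (n + 1) (c ++ [[n + 1, n + 1]])) : IsStirling2 n c := by
  refine ⟨?_, fun w hw => h.2.1 w (by simp [hw]), (List.isChain_append.1 h.2.2).1⟩
  have := h.1
  rw [baseList_succ] at this
  simpa [List.perm_append_right_iff] using this

/-- All insertions of the double letter `m` into a word. -/
def doubleInsertions (m : ℕ) : List ℕ → List (List ℕ)
  | [] => [[m, m]]
  | a :: l => (m :: m :: a :: l) :: (doubleInsertions m l).map (a :: ·)

/-- All insertions of the double letter `m` into a word, except at the front. -/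
def innerInsertions (m : ℕ) : List ℕ → List (List ℕ)
  | [] => []
  | a :: l => (doubleInsertions m l).map (a :: ·)

/-- All insertions of the double letter `m` into a cycle of `c`, except at the front. -/
def cycleInsertions (m : ℕ) : List (List ℕ) → List (List (List ℕ))
  | [] => []
  | w :: c => (innerInsertions m w).map (· :: c) ++ (cycleInsertions m c).map (w :: ·)

theorem mem_doubleInsertions {m : ℕ} {l l' : List ℕ} :
    l' ∈ doubleInsertions m l ↔ ∃ u v, l = u ++ v ∧ l' = u ++ m :: m :: v := by
  induction l generalizing l' with
  | nil => simp [doubleInsertions, and_assoc]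
  | cons a l ih =>
    simp only [doubleInsertions, List.mem_cons, List.mem_map, ih]
    constructor
    · rintro (rfl | ⟨_, ⟨u, v, rfl, rfl⟩, rfl⟩)
      · exact ⟨[], _, rfl, rfl⟩
      · exact ⟨a :: u, v, rfl, rfl⟩
    · rintro ⟨u, v, h, rfl⟩
      rcases u with _ | ⟨b, u⟩
      · left
        simp_all
      · right
        simp only [List.cons_append, List.cons.injEq] at h
        exact ⟨_, ⟨u, v, h.2, rfl⟩, by simp [h.1]⟩

theorem mem_innerInsertions {m : ℕ} {l l' : List ℕ} :
    l' ∈ innerInsertions m l ↔ ∃ u v, u ≠ [] ∧ l = u ++ v ∧ l' = u ++ m :: m :: v := by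
  rcases l with _ | ⟨a, l⟩
  · simp only [innerInsertions, List.not_mem_nil, false_iff]
    rintro ⟨u, v, hu, h, -⟩
    exact hu (List.append_eq_nil_iff.1 h.symm).1
  · simp only [innerInsertions, List.mem_map, mem_doubleInsertions]
    constructor
    · rintro ⟨_, ⟨u, v, rfl, rfl⟩, rfl⟩
      exact ⟨a :: u, v, by simp, rfl, rfl⟩
    · rintro ⟨u, v, hu, h, rfl⟩
      obtain ⟨b, u, rfl⟩ := List.exists_cons_of_ne_nil hu
      simp only [List.cons_append, List.cons.injEq] at h
      exact ⟨_, ⟨u, v, h.2, rfl⟩, by simp [h.1]⟩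

theorem mem_cycleInsertions {m : ℕ} {c d : List (List ℕ)} :
    d ∈ cycleInsertions m c ↔ ∃ c₁ c₂ u v, u ≠ [] ∧ c = c₁ ++ (u ++ v) :: c₂ ∧
      d = c₁ ++ (u ++ m :: m :: v) :: c₂ := by
  induction c generalizing d with
  | nil => simp [cycleInsertions]
  | cons w c ih =>
    simp only [cycleInsertions, List.mem_append, List.mem_map, ih, mem_innerInsertions]
    constructor
    · rintro (⟨_, ⟨u, v, hu, rfl, rfl⟩, rfl⟩ | ⟨_, ⟨c₁, c₂, u, v, hu, rfl, rfl⟩, rfl⟩)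
      · exact ⟨[], c, u, v, hu, rfl, rfl⟩
      · exact ⟨w :: c₁, c₂, u, v, hu, rfl, rfl⟩
    · rintro ⟨c₁, c₂, u, v, hu, h, rfl⟩
      rcases c₁ with _ | ⟨b, c₁⟩
      · left
        simp only [List.nil_append, List.cons.injEq] at h
        exact ⟨_, ⟨u, v, hu, h.1, rfl⟩, by simp [h.2]⟩
      · right
        simp only [List.cons_append, List.cons.injEq] at h
        exact ⟨_, ⟨c₁, c₂, u, v, hu, h.2, rfl⟩, by simp [h.1]⟩

theorem nodup_doubleInsertions {m : ℕ} {l : List ℕ} (h : m ∉ l) :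
    (doubleInsertions m l).Nodup := by
  induction l with
  | nil => simp [doubleInsertions]
  | cons a l ih =>
    simp only [List.mem_cons, not_or] at h
    refine List.nodup_cons.2 ⟨?_, (ih h.2).map (List.cons_injective)⟩
    simp [Ne.symm h.1]

theorem nodup_innerInsertions {m : ℕ} {l : List ℕ} (h : m ∉ l) :
    (innerInsertions m l).Nodup := by
  rcases l with _ | ⟨a, l⟩
  · simp [innerInsertions]
  · simp only [List.mem_cons, not_or] at h
    exact (nodup_doubleInsertions h.2).map List.cons_injective

theorem nodup_cycleInsertions {m : ℕ} {c : List (List ℕ)} (h : ∀ w ∈ c, m ∉ w) :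
    (cycleInsertions m c).Nodup := by
  induction c with
  | nil => simp [cycleInsertions]
  | cons w c ih =>
    have hw : m ∉ w := h w (by simp)
    refine List.Nodup.append ((nodup_innerInsertions hw).map fun a b hab => (List.cons.inj hab).1)
      ((ih fun w hw => h w (by simp [hw])).map List.cons_injective) ?_
    intro d hd hd'
    obtain ⟨w', hw', rfl⟩ := List.mem_map.1 hd
    obtain ⟨c', -, hc'⟩ := List.mem_map.1 hd'
    obtain ⟨u, v, -, -, rfl⟩ := mem_innerInsertions.1 hw'
    rw [(List.cons.inj hc').1] at hw
    simp at hw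

/-- All ways of adding the double letter `m` to the list of cycles `c`. -/
def extensions (m : ℕ) (c : List (List ℕ)) : List (List (List ℕ)) :=
  (c ++ [[m, m]]) :: cycleInsertions m c

theorem nodup_extensions {m : ℕ} {c : List (List ℕ)} (h : ∀ w ∈ c, m ∉ w) :
    (extensions m c).Nodup := by
  refine List.nodup_cons.2 ⟨?_, nodup_cycleInsertions h⟩
  intro hd
  obtain ⟨c₁, c₂, u, v, -, rfl, hd⟩ := mem_cycleInsertions.1 hd
  simpa using congrArg List.length hd

/-- Deleting the letter `m` from a list of cycles. -/
def deleteLetter (m : ℕ) (d : List (List ℕ)) : List (List ℕ) :=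
  (d.map (List.filter (· ≠ m))).filter (· ≠ [])

theorem deleteLetter_of_mem_extensions {m : ℕ} {c d : List (List ℕ)} (h : ∀ w ∈ c, m ∉ w)
    (h0 : ∀ w ∈ c, w ≠ []) (hd : d ∈ extensions m c) : deleteLetter m d = c := by
  have hf : ∀ l : List ℕ, m ∉ l → l.filter (· ≠ m) = l := fun l hl =>
    List.filter_eq_self.2 fun a ha => by simpa using fun e : a = m => hl (e ▸ ha)
  have hself : deleteLetter m c = c := by
    rw [deleteLetter, List.map_congr_left (g := id) fun w hw => hf w (h w hw), List.map_id]
    exact List.filter_eq_self.2 (by simpa using h0)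
  rcases List.mem_cons.1 hd with rfl | hd
  · nth_rewrite 2 [← hself]
    simp [deleteLetter]
  · obtain ⟨c₁, c₂, u, v, hu, rfl, rfl⟩ := mem_cycleInsertions.1 hd
    conv_rhs => rw [← hself]
    simp [deleteLetter]

theorem exists_mem_extensions {n : ℕ} {d : List (List ℕ)} (h : IsStirling2 (n + 1) d) :
    ∃ c, IsStirling2 n c ∧ d ∈ extensions (n + 1) c := by
  have hle : ∀ w ∈ d, ∀ a ∈ w, a ≤ n + 1 := fun w hw a ha => Nat.lt_succ_iff.1 (h.lt hw ha)
  have hm : n + 1 ∈ d.flatten := h.1.mem_iff.2 (by simp [baseList_succ])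
  obtain ⟨w, hw, hmw⟩ := List.mem_flatten.1 hm
  obtain ⟨c₁, c₂, rfl⟩ := List.append_of_mem hw
  obtain ⟨-, hcount, hhead, hst⟩ := h.2.1 w hw
  have hlew := hle w hw
  obtain ⟨u, s, rfl, hmu⟩ := List.eq_append_cons_of_mem hmw
  have hc := hcount _ hmw
  rw [List.count_append, List.count_cons_self, List.count_eq_zero.2 hmu] at hc
  have hms : n + 1 ∈ s := List.count_pos_iff.1 (by omega)
  obtain ⟨t, v, rfl, -⟩ := List.eq_append_cons_of_mem hms
  have ht : t = [] := by
    by_contra ht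
    obtain ⟨b, t, rfl⟩ := List.exists_cons_of_ne_nil ht
    have h1 := isStirlingWord_iff.1 hst (n + 1) b
      (List.Sublist.trans (by simp) (List.sublist_append_right u _))
    have h2 := hlew b (by simp)
    omega
  subst ht
  have hmv : n + 1 ∉ v := by
    rw [List.nil_append, List.count_cons_self] at hc
    exact List.count_eq_zero.1 (by omega)
  have hu : ∀ a ∈ u, a < n + 1 := fun a ha =>
    lt_of_le_of_ne (hlew a (by simp [ha])) fun e => hmu (e ▸ ha)
  have hv : ∀ a ∈ v, a < n + 1 := fun a ha =>
    lt_of_le_of_ne (hlew a (by simp [ha])) fun e => hmv (e ▸ ha)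
  by_cases hu0 : u = []
  · subst hu0
    have hv0 : v = [] := by
      refine List.eq_nil_iff_forall_not_mem.2 fun a ha => ?_
      have h1 := hhead a (by simp [ha])
      have h2 := hv a ha
      simp only [List.nil_append, List.headI_cons] at h1
      omega
    subst hv0
    have hc2 : c₂ = [] := by
      by_contra h0
      obtain ⟨w, c₂, rfl⟩ := List.exists_cons_of_ne_nil h0
      have h1 := (List.isChain_cons_cons.1 (List.isChain_append.1 h.2.2).2.1).1
      obtain ⟨b, t, rfl⟩ := List.exists_cons_of_ne_nil (h.2.1 w (by simp)).1
      have h2 := hle (b :: t) (by simp) b (by simp)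
      simp only [List.nil_append, List.headI_cons] at h1
      omega
    subst hc2
    exact ⟨c₁, h.of_append, by simp [extensions]⟩
  · exact ⟨c₁ ++ (u ++ v) :: c₂, (isStirling2_insert hu0 hu hv).1 h,
      List.mem_cons_of_mem _ (mem_cycleInsertions.2 ⟨c₁, c₂, u, v, hu0, rfl, rfl⟩)⟩

theorem isStirling2_of_mem_extensions {n : ℕ} {c d : List (List ℕ)} (h : IsStirling2 n c)
    (hd : d ∈ extensions (n + 1) c) : IsStirling2 (n + 1) d := by
  rcases List.mem_cons.1 hd with rfl | hd
  · exact isStirling2_append h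
  · obtain ⟨c₁, c₂, u, v, hu0, rfl, rfl⟩ := mem_cycleInsertions.1 hd
    exact (isStirling2_insert hu0 (fun a ha => h.lt (w := u ++ v) (by simp) (by simp [ha]))
      (fun a ha => h.lt (w := u ++ v) (by simp) (by simp [ha]))).2 h

theorem stirling2_succ (n : ℕ) :
    stirling2 (n + 1) = (stirling2 n).biUnion fun c => (extensions (n + 1) c).toFinset := by
  ext d
  simp only [Finset.mem_biUnion, mem_stirling2, List.mem_toFinset]
  exact ⟨exists_mem_extensions, fun ⟨c, hc, hd⟩ => isStirling2_of_mem_extensions hc hd⟩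

theorem sum_stirling2_succ {M : Type*} [AddCommMonoid M] (n : ℕ) (f : List (List ℕ) → M) :
    ∑ d ∈ stirling2 (n + 1), f d =
      ∑ c ∈ stirling2 n, ((extensions (n + 1) c).map f).sum := by
  have hmem : ∀ c ∈ stirling2 n, ∀ w ∈ c, n + 1 ∉ w := fun c hc w hw ha =>
    lt_irrefl _ ((mem_stirling2.1 hc).lt hw ha)
  have hdel : ∀ c ∈ stirling2 n, ∀ d ∈ extensions (n + 1) c, deleteLetter (n + 1) d = c :=
    fun c hc d hd => deleteLetter_of_mem_extensions (hmem c hc)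
      (fun w hw => ((mem_stirling2.1 hc).2.1 w hw).1) hd
  rw [stirling2_succ, Finset.sum_biUnion]
  · exact Finset.sum_congr rfl fun c hc => List.sum_toFinset f (nodup_extensions (hmem c hc))
  · intro c hc c' hc' hne
    refine Finset.disjoint_left.2 fun d hd hd' => hne ?_
    rw [← hdel c hc d (List.mem_toFinset.1 hd), ← hdel c' hc' d (List.mem_toFinset.1 hd')]

/-- The number of ascent plateaus of `l` when it is preceded by the letter `p`. -/
def ascentPlateausFrom : ℕ → List ℕ → ℕ
  | _, [] => 0
  | p, a :: l => (if p < a ∧ l.head? = some a then 1 else 0) + ascentPlateausFrom a l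

/-- The number of ascent plateaus of a word. -/
def ascentPlateaus : List ℕ → ℕ
  | [] => 0
  | a :: l => ascentPlateausFrom a l

theorem sum_range_eq_ascentPlateausFrom (p : ℕ) (l : List ℕ) :
    ∑ j ∈ Finset.range l.length, (if j + 1 < l.length ∧ (p :: l).getD j 0 < l.getD j 0 ∧
      l.getD j 0 = l.getD (j + 1) 0 then 1 else 0) = ascentPlateausFrom p l := by
  induction l generalizing p with
  | nil => rfl
  | cons a l ih =>
    rw [ascentPlateausFrom, ← ih a, List.length_cons, Finset.sum_range_succ', add_comm]
    congr 1
    · rcases l with _ | ⟨b, l⟩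
      · simp
      · simp [eq_comm]
    · refine Finset.sum_congr rfl fun j _ => ?_
      simp only [List.getD_cons_succ, Nat.add_lt_add_iff_right]

theorem capSt_eq (c : List (List ℕ)) : capSt c = (c.map ascentPlateaus).sum := by
  unfold capSt
  congr 1
  refine List.map_congr_left fun w _ => ?_
  rcases w with _ | ⟨a, l⟩
  · rfl
  · rw [ascentPlateaus, ← sum_range_eq_ascentPlateausFrom, Finset.card_filter, List.length_cons,
      Finset.sum_range_succ']
    simp

theorem head?_of_mem_doubleInsertions {m a : ℕ} (ha : a ≠ m) {l l' : List ℕ}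
    (h : l' ∈ doubleInsertions m l) (h' : l'.head? = some a) : l.head? = some a := by
  obtain ⟨u, v, rfl, rfl⟩ := mem_doubleInsertions.1 h
  rcases u with _ | ⟨b, u⟩
  · simp [ha.symm] at h'
  · simpa using h'

theorem sum_doubleInsertions {R : Type*} [CommRing R] (x : R) {m p : ℕ} (hp : p < m)
    {l : List ℕ} (hl : ∀ a ∈ l, a < m) :
    ((doubleInsertions m l).map fun l' => x ^ ascentPlateausFrom p l').sum =
      2 * (ascentPlateausFrom p l : R) * x ^ ascentPlateausFrom p l +
        ((l.length : R) + 1 - 2 * (ascentPlateausFrom p l : R)) *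
          x ^ (ascentPlateausFrom p l + 1) := by
  induction l generalizing p with
  | nil => simp [doubleInsertions, ascentPlateausFrom, hp]
  | cons a l ih =>
    have ha : a < m := hl a (by simp)
    have ih := ih ha fun b hb => hl b (by simp [hb])
    by_cases hpa : p < a ∧ l.head? = some a
    · obtain ⟨hpa, hhead⟩ := hpa
      obtain ⟨t, rfl⟩ := List.head?_eq_some_iff.1 hhead
      simp only [doubleInsertions, List.map_cons, List.map_map, List.sum_cons,
        Function.comp_def, ascentPlateausFrom, hp, hpa, ha, ha.not_gt, ha.ne', lt_irrefl,
        List.head?_cons, Option.some.injEq, List.length_cons, false_and, and_true, and_false,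
        if_true, if_false, Nat.cast_add, Nat.cast_one, zero_add] at ih ⊢
      simp only [pow_add, List.sum_map_mul_left, pow_one] at ih ⊢
      linear_combination x * ih
    · have hmap : ((doubleInsertions m l).map (a :: ·)).map
          (fun l' => x ^ ascentPlateausFrom p l') =
          (doubleInsertions m l).map fun l' => x ^ ascentPlateausFrom a l' := by
        rw [List.map_map]
        refine List.map_congr_left fun l' hl' => ?_
        have : ¬(p < a ∧ l'.head? = some a) := fun h =>
          hpa ⟨h.1, head?_of_mem_doubleInsertions ha.ne hl' h.2⟩
        simp [ascentPlateausFrom, this]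
      rw [doubleInsertions, List.map_cons, List.sum_cons, hmap, ih]
      simp only [ascentPlateausFrom, hpa, hp, ha.not_gt, List.head?_cons, lt_irrefl,
        and_true, false_and, if_true, if_false, zero_add, List.length_cons, Nat.cast_add, Nat.cast_one]
      ring

theorem sum_innerInsertions {R : Type*} [CommRing R] (x : R) {m : ℕ}
    {w : List ℕ} (hw : ∀ a ∈ w, a < m) :
    ((innerInsertions m w).map fun w' => x ^ ascentPlateaus w').sum =
      2 * (ascentPlateaus w : R) * x ^ ascentPlateaus w +
        ((w.length : R) - 2 * (ascentPlateaus w : R)) * x ^ (ascentPlateaus w + 1) := by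
  rcases w with _ | ⟨a, l⟩
  · simp [innerInsertions, ascentPlateaus]
  · have := sum_doubleInsertions x (hw a (by simp)) fun b hb => hw b (List.mem_cons_of_mem a hb)
    simpa [innerInsertions, ascentPlateaus, Function.comp_def] using this

theorem sum_cycleInsertions {R : Type*} [CommRing R] (x : R) {m : ℕ}
    {c : List (List ℕ)} (hc : ∀ w ∈ c, ∀ a ∈ w, a < m) :
    ((cycleInsertions m c).map fun d => x ^ capSt d).sum =
      2 * (capSt c : R) * x ^ capSt c +
        ((c.flatten.length : R) - 2 * (capSt c : R)) * x ^ (capSt c + 1) := by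
  simp only [capSt_eq]
  induction c with
  | nil => simp [cycleInsertions]
  | cons w c ih =>
    have ih := ih fun w hw => hc w (by simp [hw])
    have hw := sum_innerInsertions x (hc w (by simp))
    simp only [cycleInsertions, List.map_append, List.map_map, List.sum_append, Function.comp_def,
      List.map_cons, List.sum_cons, pow_add, List.sum_map_mul_right, List.sum_map_mul_left,
      List.flatten_cons, List.length_append, Nat.cast_add, pow_one] at ih hw ⊢
    rw [ih, hw]
    ring

theorem cyc_of_mem_cycleInsertions {m : ℕ} {c d : List (List ℕ)} (hd : d ∈ cycleInsertions m c) :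
    cyc d = cyc c := by
  obtain ⟨c₁, c₂, u, v, -, rfl, rfl⟩ := mem_cycleInsertions.1 hd
  simp [cyc]

open MvPolynomial in
theorem X_mul_pderiv_X_pow_mul_X_pow (k l : ℕ) :
    (X 0 : MvPolynomial (Fin 2) ℚ) * pderiv 0 (X 0 ^ k * X 1 ^ l) =
      (k : MvPolynomial (Fin 2) ℚ) * X 0 ^ k * X 1 ^ l := by
  have h : pderiv 0 (X 1 : MvPolynomial (Fin 2) ℚ) = 0 := pderiv_X_of_ne (by simp)
  rcases k with _ | k
  · simp [Derivation.leibniz_pow, h]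
  · simp [Derivation.leibniz, Derivation.leibniz_pow, h]
    ring

open MvPolynomial in
/-- `Q_0(x,q) = 1` and, for every `n ≥ 0`,
`Q_{n+1}(x,q) = (q + 2nx) Q_n(x,q) + 2x(1-x) ∂Q_n/∂x`. -/
theorem stmt6 :
    Qmv 0 = 1 ∧
    ∀ n : ℕ,
      Qmv (n + 1) =
        (X 1 + ((2 * n : ℕ) : MvPolynomial (Fin 2) ℚ) * X 0) * Qmv n +
          2 * X 0 * (1 - X 0) * pderiv 0 (Qmv n) := by
  refine ⟨?_, fun n => ?_⟩
  · have h : stirling2 0 = {[]} := by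
      ext c
      rw [mem_stirling2, Finset.mem_singleton]
      constructor
      · intro h
        refine List.eq_nil_iff_forall_not_mem.2 fun w hw => (h.2.1 w hw).1 ?_
        exact List.flatten_eq_nil_iff.1 h.1.eq_nil w hw
      · rintro rfl
        exact ⟨List.Perm.refl _, by simp, List.isChain_nil⟩
    simp [Qmv, h, capSt, cyc]
  · have hd : X 0 * pderiv 0 (Qmv n) = ∑ c ∈ stirling2 n,
        ((capSt c : ℕ) : MvPolynomial (Fin 2) ℚ) * X 0 ^ capSt c * X 1 ^ cyc c := by
      rw [Qmv, map_sum, Finset.mul_sum]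
      exact Finset.sum_congr rfl fun c _ => X_mul_pderiv_X_pow_mul_X_pow _ _
    rw [show ∀ a b D : MvPolynomial (Fin 2) ℚ, a + 2 * X 0 * b * D = a + 2 * b * (X 0 * D) by
      intros; ring, hd, Qmv, sum_stirling2_succ, Qmv, Finset.mul_sum, Finset.mul_sum,
      ← Finset.sum_add_distrib]
    refine Finset.sum_congr rfl fun c hc => ?_
    have hc := mem_stirling2.1 hc
    have hsum := sum_cycleInsertions (X 0 : MvPolynomial (Fin 2) ℚ) (m := n + 1)
      (c := c) fun w hw a ha => hc.lt hw ha
    have hlen : c.flatten.length = 2 * n := by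
      rw [hc.1.length_eq]
      simp [baseList, mul_comm]
    have hcap : capSt (c ++ [[n + 1, n + 1]]) = capSt c := by
      simp [capSt_eq, ascentPlateaus, ascentPlateausFrom]
    rw [extensions, List.map_cons, List.sum_cons, List.map_congr_left
      (g := fun d => X 0 ^ capSt d * X 1 ^ cyc c)
      fun d hd => by rw [cyc_of_mem_cycleInsertions hd], List.sum_map_mul_right, hsum, hcap, hlen,
      cyc, cyc, List.length_append, List.length_singleton]
    ring
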